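/- Let ε, ε̃ ∈ {0, 1} with ε ≠ ε̃, and let φ : ℝ⁶ → ℝ be a C² function satisfying, at every point of ℝ⁶: (i) ∂₁φ = 0, ∂₂φ = 0, ∂₄φ = 0 and ∂₅φ = 0; (ii) ε̃·∂₃φ = ε·∂₆φ; (iii) ∂₃∂₃φ = 0, ∂₆∂₆φ = 0 and ∂₃∂₆φ = 0. Then there exist constants a₁, c ∈ ℝ such that φ(x) = (3a₁/2)(ε·x³ + ε̃·x⁶) + c for all x ∈ ℝ⁶. -/

import Mathlib

/-- Partial derivative of `φ : ℝ⁶ → ℝ` in the `i`-th coordinate direction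
(`i : Fin 6` is the 0-based index, so `∂ᵢφ` of the paper is `pd (i-1) φ`). -/
noncomputable def pd (i : Fin 6) (φ : (Fin 6 → ℝ) → ℝ) : (Fin 6 → ℝ) → ℝ :=
  fun x => fderiv ℝ φ x (Pi.single i 1)

theorem pd_pd_eq {φ : (Fin 6 → ℝ) → ℝ} (hφ : ContDiff ℝ 2 φ) (i j : Fin 6) (x : Fin 6 → ℝ) :
    pd i (pd j φ) x = fderiv ℝ (fderiv ℝ φ) x (Pi.single i 1) (Pi.single j 1) := by
  have hd : DifferentiableAt ℝ (fderiv ℝ φ) x :=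
    (hφ.fderiv_right (m := 1) (by norm_num)).differentiable one_ne_zero x
  change fderiv ℝ (fun y => fderiv ℝ φ y (Pi.single j 1)) x (Pi.single i 1) = _
  rw [fderiv_clm_apply hd (differentiableAt_const _)]
  simp

theorem pd_comm {φ : (Fin 6 → ℝ) → ℝ} (hφ : ContDiff ℝ 2 φ) (i j : Fin 6) (x : Fin 6 → ℝ) :
    pd i (pd j φ) x = pd j (pd i φ) x := by
  rw [pd_pd_eq hφ, pd_pd_eq hφ]
  exact (hφ.contDiffAt.isSymmSndFDerivAt (by simp)).eq _ _

theorem differentiable_pd {φ : (Fin 6 → ℝ) → ℝ} (hφ : ContDiff ℝ 2 φ) (i : Fin 6) :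
    Differentiable ℝ (pd i φ) :=
  ((hφ.fderiv_right (m := 1) (by norm_num)).differentiable one_ne_zero).clm_apply
    (differentiable_const _)

theorem eq_of_pd_eq_zero {φ : (Fin 6 → ℝ) → ℝ} (hφ : Differentiable ℝ φ)
    (h : ∀ i x, pd i φ x = 0) (x y : Fin 6 → ℝ) : φ x = φ y := by
  refine is_const_of_fderiv_eq_zero hφ (fun z => ?_) x y
  refine ContinuousLinearMap.coe_injective (LinearMap.pi_ext' fun i => LinearMap.ext_ring ?_)
  simpa [pd] using h i z

theorem exists_affine_of_pd_eq_zero {φ : (Fin 6 → ℝ) → ℝ} (hφ : ContDiff ℝ 2 φ) (i : Fin 6)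
    (h : ∀ j, j ≠ i → ∀ x, pd j φ x = 0) (hi : ∀ x, pd i (pd i φ) x = 0) :
    ∃ a c : ℝ, ∀ x, φ x = a * x i + c := by
  have hconst : ∀ x, pd i φ x = pd i φ 0 := fun x => by
    refine eq_of_pd_eq_zero (differentiable_pd hφ i) (fun j y => ?_) x 0
    rcases eq_or_ne j i with rfl | hj
    · exact hi y
    · rw [pd_comm hφ, funext (h j hj)]
      simp [pd]
  have hd : Differentiable ℝ φ := hφ.differentiable two_ne_zero
  set L : (Fin 6 → ℝ) →L[ℝ] ℝ := pd i φ 0 • ContinuousLinearMap.proj i with hL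
  have hpd : ∀ j x, pd j (fun y => φ y - L y) x = 0 := fun j x => by
    have hs : pd j (fun y => φ y - L y) x = pd j φ x - L (Pi.single j 1) := by
      simp only [pd]
      rw [fderiv_fun_sub (hd x) L.differentiableAt, L.fderiv]
      rfl
    rw [hs]
    rcases eq_or_ne j i with rfl | hj
    · simp [hL, hconst x]
    · simp [hL, h j hj x, hj.symm]
  refine ⟨pd i φ 0, φ 0, fun x => ?_⟩
  have hx : φ x - pd i φ 0 * x i = φ 0 := by
    simpa [hL] using eq_of_pd_eq_zero (hd.sub L.differentiable) hpd x 0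
  linarith

/-- Integration of the Eisenhart equations for the defining function of a
projective motion on the rigid 6-dimensional h-space of type [33].
Coordinates: x¹,…,x⁶ are `x 0, …, x 5`. -/
theorem stmt_5 (ε ε' : ℝ) (hε : ε = 0 ∨ ε = 1) (hε' : ε' = 0 ∨ ε' = 1) (hne : ε ≠ ε')
    (φ : (Fin 6 → ℝ) → ℝ) (hφ : ContDiff ℝ 2 φ)
    -- (i) ∂₁φ = 0, ∂₂φ = 0, ∂₄φ = 0, ∂₅φ = 0
    (h1 : ∀ x, pd 0 φ x = 0) (h2 : ∀ x, pd 1 φ x = 0)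
    (h4 : ∀ x, pd 3 φ x = 0) (h5 : ∀ x, pd 4 φ x = 0)
    -- (ii) ε̃·∂₃φ = ε·∂₆φ
    (h36 : ∀ x, ε' * pd 2 φ x = ε * pd 5 φ x)
    -- (iii) ∂₃∂₃φ = 0, ∂₆∂₆φ = 0, ∂₃∂₆φ = 0
    (h33 : ∀ x, pd 2 (pd 2 φ) x = 0)
    (h66 : ∀ x, pd 5 (pd 5 φ) x = 0)
    (h36' : ∀ x, pd 2 (pd 5 φ) x = 0) :
    ∃ a₁ c : ℝ, ∀ x : Fin 6 → ℝ,
      φ x = (3 * a₁ / 2) * (ε * x 2 + ε' * x 5) + c := by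
  rcases hε with rfl | rfl <;> rcases hε' with rfl | rfl
  · exact absurd rfl hne
  · have h3 : ∀ x, pd 2 φ x = 0 := fun x => by simpa using h36 x
    obtain ⟨a, c, h⟩ := exists_affine_of_pd_eq_zero hφ 5
      (fun j hj => by fin_cases j <;> first | assumption | exact absurd rfl hj) h66
    exact ⟨2 * a / 3, c, fun x => by rw [h x]; ring⟩
  · have h6 : ∀ x, pd 5 φ x = 0 := fun x => by simpa using (h36 x).symm
    obtain ⟨a, c, h⟩ := exists_affine_of_pd_eq_zero hφ 2
      (fun j hj => by fin_cases j <;> first | assumption | exact absurd rfl hj) h33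
    exact ⟨2 * a / 3, c, fun x => by rw [h x]; ring⟩
  · exact absurd rfl hne
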